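/- arXiv:2205.15814 — 8 statements merged into one kernel-verified Lean document; each statement's English description precedes it below -/
import Mathlib

section
/- (Proposition 1, batch-hard form: equivalence with the margin triplet loss) Let S be a real n×n matrix with n ≥ 2, σ_gt a permutation of {1,…,n}, and m ≥ 0. Let S_m be the margin-shifted matrix with S_m[i,j] = S[i,j] + m if j = σ_gt(i) and S_m[i,j] = S[i,j] otherwise. Then the batch-hard structured linear assignment loss of S_m equals the batch-hard margin triplet loss: L̂(S_m, σ_gt) = Σ_i max(0, S[i, σ_gt(i)] + m − min over j ≠ σ_gt(i) of S[i, j]). -/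
/-- The infimum over a finite set splits into the value at a point and the infimum over the
remaining points. -/
theorem Finset.inf'_eq_inf_inf'_erase {ι α : Type*} [DecidableEq ι] [SemilatticeInf α]
    {s : Finset ι} {k : ι} (hk : k ∈ s) (hs : s.Nonempty) (he : (s.erase k).Nonempty)
    (f : ι → α) : s.inf' hs f = f k ⊓ (s.erase k).inf' he f := by
  rw [← Finset.inf'_insert]
  exact Finset.inf'_congr hs (Finset.insert_erase hk).symm fun _ _ => rfl


/-- Proposition 1 (batch-hard form): the batch-hard structured linear assignment
loss of the margin-shifted matrix `S_m[i,j] = S[i,j] + m·[j = σ_gt(i)]` equals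
the batch-hard margin triplet loss. -/
theorem batch_hard_margin_loss_eq_triplet
    (n : ℕ) (hn : 2 ≤ n) (S : Matrix (Fin n) (Fin n) ℝ)
    (σgt : Equiv.Perm (Fin n)) (m : ℝ) (hm : 0 ≤ m) :
    (∑ i, (S i (σgt i) + m)) -
      (∑ i, Finset.univ.inf'
          (Finset.univ_nonempty_iff.mpr (Fin.pos_iff_nonempty.mp (by omega)))
          (fun j => S i j + if j = σgt i then m else 0))
    = ∑ i, max 0 (S i (σgt i) + m -
        (Finset.univ.erase (σgt i)).inf'
          (Finset.card_pos.mp (by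
            rw [Finset.card_erase_of_mem (Finset.mem_univ _), Finset.card_univ,
              Fintype.card_fin]
            omega))
          (fun j => S i j)) := by
  rw [← Finset.sum_sub_distrib]
  refine Finset.sum_congr rfl fun i _ => ?_
  have he : (Finset.univ.erase (σgt i)).Nonempty :=
    Finset.card_pos.mp (by
      rw [Finset.card_erase_of_mem (Finset.mem_univ _), Finset.card_univ, Fintype.card_fin]
      omega)
  have shift_eq : (Finset.univ.erase (σgt i)).inf' he
      (fun j => S i j + if j = σgt i then m else 0) =
      (Finset.univ.erase (σgt i)).inf' he (fun j => S i j) :=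
    Finset.inf'_congr he rfl fun j hj => by simp [Finset.ne_of_mem_erase hj]
  rw [Finset.inf'_eq_inf_inf'_erase (Finset.mem_univ (σgt i)) _ he, shift_eq, if_pos rfl,
    ← max_sub_sub_left, sub_self]
end

section
/- (Proposition 1, optimality characterization) Let S be a real n×n matrix with n ≥ 2, σ_gt a permutation of {1,…,n}, m ≥ 0, and S_m the margin-shifted matrix with S_m[i,j] = S[i,j] + m·[j = σ_gt(i)]. Then the batch-hard structured linear assignment loss L̂(S_m, σ_gt) is zero if and only if for every i and every j ≠ σ_gt(i), S[i, σ_gt(i)] + m ≤ S[i, j], i.e. the distance of every positive pair is at least m smaller than the distance of every negative pair with the same anchor. -/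
/-- Proposition 1 (optimality characterization): the batch-hard structured linear
assignment loss of the margin-shifted matrix `S_m[i,j] = S[i,j] + m·[j = σ_gt(i)]`
is zero iff every positive pair is at least `m` closer than every negative pair
sharing the same anchor. -/
theorem batch_hard_margin_loss_eq_zero_iff
    (n : ℕ) (hn : 2 ≤ n) (S : Matrix (Fin n) (Fin n) ℝ)
    (σgt : Equiv.Perm (Fin n)) (m : ℝ) (hm : 0 ≤ m) :
    (∑ i, (S i (σgt i) + m)) -
      (∑ i, Finset.univ.inf'
          (Finset.univ_nonempty_iff.mpr (Fin.pos_iff_nonempty.mp (by omega)))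
          (fun j => S i j + if j = σgt i then m else 0)) = 0
    ↔ ∀ i, ∀ j, j ≠ σgt i → S i (σgt i) + m ≤ S i j := by
  rw [sub_eq_zero, eq_comm, Finset.sum_eq_sum_iff_of_le]
  · refine ⟨fun h i j hj => ?_, fun h i _ => ?_⟩
    · rw [← h i (Finset.mem_univ i), Finset.inf'_le_iff]
      exact ⟨j, Finset.mem_univ j, by simp [hj]⟩
    · refine le_antisymm ?_ (Finset.le_inf' _ _ fun j _ => ?_)
      · rw [Finset.inf'_le_iff]
        exact ⟨σgt i, Finset.mem_univ _, by simp⟩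
      · by_cases hj : j = σgt i
        · simp [hj]
        · simpa [hj] using h i j hj
  · intro i _
    rw [Finset.inf'_le_iff]
    exact ⟨σgt i, Finset.mem_univ _, by simp⟩
end

section
/- (Proposition 2: the smoothed structured linear assignment loss with batch-hard mining equals the normalized-temperature cross entropy) Let S be a real n×n matrix, σ_gt a permutation of {1,…,n}, and τ > 0. Under batch-hard mining (relaxing permutation matrices to binary row-stochastic matrices, equivalently to functions u : {1,…,n} → {1,…,n}), the log-sum-exp smoothed loss factorizes as τ · log Σ over all functions u of exp(−(Σ_i S[i, u(i)])/τ) = τ · Σ_i log Σ_j exp(−S[i,j]/τ); hence the batch-hard smoothed loss equals L̂_τ(S, σ_gt) = Σ_i S[i, σ_gt(i)] + τ Σ_i log Σ_j exp(−S[i,j]/τ), which is the normalized-temperature cross entropy (InfoNCE) objective. -/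
/-- The log-partition function of an additive score over all functions `u` is the sum of the
log-partition functions of the individual coordinates. -/
theorem Real.log_sum_pi_exp_sum {ι κ : Type*} [Fintype ι] [DecidableEq ι] [Fintype κ]
    [Nonempty κ] (f : ι → κ → ℝ) :
    Real.log (∑ u : ι → κ, Real.exp (∑ i, f i (u i)))
      = ∑ i, Real.log (∑ j, Real.exp (f i j)) := by
  simp_rw [Real.exp_sum]
  rw [← Fintype.prod_sum fun i j => Real.exp (f i j), Real.log_prod]
  exact fun i _ => ne_of_gt (Finset.sum_pos (fun j _ => Real.exp_pos _) Finset.univ_nonempty)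

/-- Proposition 2: under batch-hard mining (assignments relaxed to arbitrary
functions `u : Fin n → Fin n`), the log-sum-exp smoothed assignment objective
factorizes over rows; hence the batch-hard smoothed structured linear assignment
loss equals the normalized-temperature cross entropy (InfoNCE) objective. -/
theorem smoothed_batch_hard_loss_eq_infonce
    (n : ℕ) (S : Matrix (Fin n) (Fin n) ℝ) (σgt : Equiv.Perm (Fin n))
    (τ : ℝ) (hτ : 0 < τ) :
    (τ * Real.log (∑ u : Fin n → Fin n, Real.exp (-(∑ i, S i (u i)) / τ))
      = τ * ∑ i, Real.log (∑ j, Real.exp (-S i j / τ)))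
    ∧ ((∑ i, S i (σgt i)) +
        τ * Real.log (∑ u : Fin n → Fin n, Real.exp (-(∑ i, S i (u i)) / τ))
      = (∑ i, S i (σgt i)) + τ * ∑ i, Real.log (∑ j, Real.exp (-S i j / τ))) := by
  have key : Real.log (∑ u : Fin n → Fin n, Real.exp (-(∑ i, S i (u i)) / τ))
      = ∑ i, Real.log (∑ j, Real.exp (-S i j / τ)) := by
    rcases isEmpty_or_nonempty (Fin n) with h | h
    · simp
    · simp_rw [← Finset.sum_neg_distrib, Finset.sum_div]
      exact Real.log_sum_pi_exp_sum fun i j => -S i j / τ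
  rw [key]
  exact ⟨rfl, rfl⟩
end

section
/- (Eigenvalue lower bound for quadratic assignment, lower half of Burkard's Theorem 5) Let A and B be real symmetric n×n matrices with eigenvalues (listed with multiplicity) λ_A(1),…,λ_A(n) and λ_B(1),…,λ_B(n). Then for every permutation σ of {1,…,n}: min over permutations π of Σ_i λ_A(i)·λ_B(π(i)) ≤ Σ_{i,j} A[i,j]·B[σ(i), σ(j)]. The left-hand side is the minimum scalar product ⟨λ_A, λ_B⟩₋ of the eigenvalue sequences, attained by pairing the eigenvalues of A sorted increasingly with those of B sorted decreasingly. -/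
theorem inf'_perm_sum_mul_le_of_mem_doublyStochastic {ι : Type*} [Fintype ι] [DecidableEq ι]
    {M : Matrix ι ι ℝ} (hM : M ∈ doublyStochastic ℝ ι) (a b : ι → ℝ) :
    Finset.univ.inf' Finset.univ_nonempty (fun π : Equiv.Perm ι => ∑ i, a i * b (π i))
      ≤ ∑ i, ∑ j, a i * M i j * b j := by
  obtain ⟨w, hw, hw1, rfl⟩ := exists_eq_sum_perm_of_mem_doublyStochastic hM
  have key : ∑ i, ∑ j, a i * (∑ π, w π • π.permMatrix ℝ) i j * b j
      = ∑ π : Equiv.Perm ι, w π * ∑ i, a i * b (π i) := by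
    have hrow (π : Equiv.Perm ι) (i : ι) :
        ∑ j, a i * (w π • π.permMatrix ℝ) i j * b j = w π * (a i * b (π i)) := by
      simp [Equiv.Perm.permMatrix, PEquiv.toMatrix_apply, mul_left_comm, mul_assoc]
    simp only [Matrix.sum_apply, Finset.mul_sum, Finset.sum_mul, ← hrow]
    rw [Finset.sum_comm (s := (Finset.univ : Finset (Equiv.Perm ι)))]
    exact Finset.sum_congr rfl fun i _ => Finset.sum_comm
  rw [key]
  calc _ = ∑ π, w π * Finset.univ.inf' Finset.univ_nonempty
        (fun π : Equiv.Perm ι => ∑ i, a i * b (π i)) := by rw [← Finset.sum_mul, hw1, one_mul]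
    _ ≤ _ := Finset.sum_le_sum fun π _ =>
        mul_le_mul_of_nonneg_left (Finset.inf'_le _ (Finset.mem_univ π)) (hw π)

theorem Matrix.sq_entries_mem_doublyStochastic_of_mem_orthogonalGroup {ι : Type*} [Fintype ι]
    [DecidableEq ι] {W : Matrix ι ι ℝ} (hW : W ∈ Matrix.orthogonalGroup ι ℝ) :
    W.map (· ^ 2) ∈ doublyStochastic ℝ ι := by
  refine mem_doublyStochastic_iff_sum.2 ⟨fun i j => sq_nonneg _, fun i => ?_, fun j => ?_⟩
  · simpa [Matrix.mul_apply, sq] using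
      congrFun₂ ((Matrix.mem_orthogonalGroup_iff ι ℝ).1 hW) i i
  · simpa [Matrix.mul_apply, sq] using
      congrFun₂ ((Matrix.mem_orthogonalGroup_iff' ι ℝ).1 hW) j j

theorem Matrix.IsHermitian.eq_eigenvectorUnitary_mul_diagonal_mul_transpose {ι : Type*} [Fintype ι]
    [DecidableEq ι] {A : Matrix ι ι ℝ} (hA : A.IsHermitian) :
    A = (hA.eigenvectorUnitary : Matrix ι ι ℝ) * Matrix.diagonal hA.eigenvalues *
      (hA.eigenvectorUnitary : Matrix ι ι ℝ).transpose := by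
  conv_lhs => rw [hA.spectral_theorem, Unitary.conjStarAlgAut_apply]
  rfl

theorem Matrix.trace_diagonal_mul_mul_diagonal_mul_transpose {ι : Type*} [Fintype ι]
    [DecidableEq ι] (a b : ι → ℝ) (W : Matrix ι ι ℝ) :
    (Matrix.diagonal a * W * Matrix.diagonal b * W.transpose).trace
      = ∑ i, ∑ j, a i * W.map (· ^ 2) i j * b j := by
  simp only [Matrix.trace, Matrix.diag, Matrix.mul_apply (N := W.transpose),
    Matrix.mul_diagonal, Matrix.diagonal_mul, Matrix.transpose_apply, Matrix.map_apply]
  exact Finset.sum_congr rfl fun i _ => Finset.sum_congr rfl fun j _ => by ring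

/-- Eigenvalue lower bound for the quadratic assignment cost (lower half of
Burkard's Theorem 5): for symmetric `A`, `B`, the minimum scalar product of the
eigenvalue sequences lower-bounds `Σ_{i,j} A[i,j]·B[σ(i),σ(j)]` for every
permutation `σ`. -/
theorem min_scalar_product_eigenvalues_le_qap_cost
    (n : ℕ) (A B : Matrix (Fin n) (Fin n) ℝ)
    (hA : A.IsHermitian) (hB : B.IsHermitian) (σ : Equiv.Perm (Fin n)) :
    Finset.univ.inf' Finset.univ_nonempty
        (fun π : Equiv.Perm (Fin n) =>
          ∑ i, hA.eigenvalues i * hB.eigenvalues (π i))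
      ≤ ∑ i, ∑ j, A i j * B (σ i) (σ j) := by
  set U : Matrix (Fin n) (Fin n) ℝ := ↑hA.eigenvectorUnitary with hU
  set V : Matrix (Fin n) (Fin n) ℝ :=
    (hB.eigenvectorUnitary : Matrix (Fin n) (Fin n) ℝ).submatrix σ id with hV
  have hUo : U ∈ Matrix.orthogonalGroup (Fin n) ℝ := hA.eigenvectorUnitary.2
  have hVo : V ∈ Matrix.orthogonalGroup (Fin n) ℝ := by
    have h := (Matrix.mem_orthogonalGroup_iff' (Fin n) ℝ).1 hB.eigenvectorUnitary.2
    rw [Matrix.mem_orthogonalGroup_iff', ← h]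
    ext i j
    simp only [hV, Matrix.mul_apply, Matrix.transpose_apply,
      Matrix.submatrix_apply, id]
    exact Equiv.sum_comp σ fun k => (hB.eigenvectorUnitary : Matrix (Fin n) (Fin n) ℝ) k i *
      (hB.eigenvectorUnitary : Matrix (Fin n) (Fin n) ℝ) k j
  have hBσ : B.submatrix σ σ = V * Matrix.diagonal hB.eigenvalues * V.transpose := by
    conv_lhs => rw [hB.eq_eigenvectorUnitary_mul_diagonal_mul_transpose]
    ext i j
    simp [hV, Matrix.mul_apply]
  have hsum : ∑ i, ∑ j, A i j * B (σ i) (σ j) = (A * B.submatrix σ σ).trace := by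
    simp only [Matrix.trace, Matrix.diag, Matrix.mul_apply, Matrix.submatrix_apply]
    refine Finset.sum_congr rfl fun i _ => Finset.sum_congr rfl fun j _ => ?_
    rw [show B (σ j) (σ i) = B (σ i) (σ j) by simpa using hB.apply (σ i) (σ j)]
  have htrace : (A * B.submatrix σ σ).trace = (Matrix.diagonal hA.eigenvalues * (U.transpose * V) *
      Matrix.diagonal hB.eigenvalues * (U.transpose * V).transpose).trace := by
    conv_lhs => rw [hBσ, hA.eq_eigenvectorUnitary_mul_diagonal_mul_transpose]
    simp only [Matrix.transpose_mul, Matrix.transpose_transpose, Matrix.mul_assoc, ← hU]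
    rw [Matrix.trace_mul_comm U]
    simp only [Matrix.mul_assoc]
  rw [hsum, htrace, Matrix.trace_diagonal_mul_mul_diagonal_mul_transpose]
  exact inf'_perm_sum_mul_le_of_mem_doublyStochastic
    (Matrix.sq_entries_mem_doublyStochastic_of_mem_orthogonalGroup
      (mul_mem (Unitary.star_mem hUo) hVo)) _ _
end

section
/- (Eigenvalue upper bound for quadratic assignment, upper half of Burkard's Theorem 5) Let A and B be real symmetric n×n matrices with eigenvalues (listed with multiplicity) λ_A(1),…,λ_A(n) and λ_B(1),…,λ_B(n). Then for every permutation σ of {1,…,n}: Σ_{i,j} A[i,j]·B[σ(i), σ(j)] ≤ max over permutations π of Σ_i λ_A(i)·λ_B(π(i)). The right-hand side is the maximum scalar product ⟨λ_A, λ_B⟩₊ of the eigenvalue sequences, attained by pairing the eigenvalues of A and of B both sorted increasingly. -/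
/-- The entrywise square of a real orthogonal matrix is doubly stochastic. -/
theorem Matrix.of_sq_mem_doublyStochastic {m : Type*} [Fintype m] [DecidableEq m]
    {W : Matrix m m ℝ} (hW : W ∈ Matrix.orthogonalGroup m ℝ) :
    Matrix.of (fun i j => W i j ^ 2) ∈ doublyStochastic ℝ m := by
  rw [mem_doublyStochastic_iff_sum]
  refine ⟨fun i j => sq_nonneg _, fun i => ?_, fun j => ?_⟩
  · have h := congrFun₂ (Matrix.mem_orthogonalGroup_iff m ℝ |>.1 hW) i i
    simpa [Matrix.mul_apply, Matrix.star_eq_conjTranspose, sq] using h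
  · have h := congrFun₂ (Matrix.mem_orthogonalGroup_iff' m ℝ |>.1 hW) j j
    simpa [Matrix.mul_apply, Matrix.star_eq_conjTranspose, sq] using h

/-- The bilinear form of a doubly stochastic matrix is bounded by the maximum scalar product. -/
theorem sum_mul_doublyStochastic_le_sup' {m : Type*} [Fintype m] [DecidableEq m]
    {S : Matrix m m ℝ} (hS : S ∈ doublyStochastic ℝ m) (a b : m → ℝ) :
    ∑ i, ∑ j, S i j * (a i * b j)
      ≤ Finset.univ.sup' Finset.univ_nonempty
          (fun π : Equiv.Perm m => ∑ i, a i * b (π i)) := by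
  obtain ⟨w, hw0, hw1, rfl⟩ := exists_eq_sum_perm_of_mem_doublyStochastic hS
  have hperm (π : Equiv.Perm m) :
      ∑ i, ∑ j, π.permMatrix ℝ i j * (a i * b j) = ∑ i, a i * b (π i) := by
    simp [Equiv.Perm.permMatrix, PEquiv.toMatrix_apply]
  calc ∑ i, ∑ j, (∑ π : Equiv.Perm m, w π • π.permMatrix ℝ) i j * (a i * b j)
      = ∑ π : Equiv.Perm m, w π * ∑ i, ∑ j, π.permMatrix ℝ i j * (a i * b j) := by
        simp only [Matrix.sum_apply, Matrix.smul_apply, smul_eq_mul, Finset.sum_mul,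
          Finset.mul_sum, mul_assoc]
        exact Finset.sum_comm_cycle
    _ ≤ ∑ π : Equiv.Perm m, w π * Finset.univ.sup' Finset.univ_nonempty
          (fun π : Equiv.Perm m => ∑ i, a i * b (π i)) := by
        gcongr with π
        · exact hw0 π
        · rw [hperm]
          exact Finset.le_sup' (fun π : Equiv.Perm m => ∑ i, a i * b (π i)) (Finset.mem_univ π)
    _ = _ := by rw [← Finset.sum_mul, hw1, one_mul]

/-- The entries of a real symmetric matrix in terms of its spectral decomposition. -/
theorem Matrix.IsHermitian.apply_eq_sum_eigenvalues {m : Type*} [Fintype m] [DecidableEq m]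
    {A : Matrix m m ℝ} (hA : A.IsHermitian) (i j : m) :
    A i j = ∑ k, hA.eigenvalues k *
      ((hA.eigenvectorUnitary : Matrix m m ℝ) i k * (hA.eigenvectorUnitary : Matrix m m ℝ) j k) := by
  have h := congrFun₂ hA.spectral_theorem i j
  rw [Unitary.conjStarAlgAut_apply, Matrix.mul_apply] at h
  rw [h]
  refine Finset.sum_congr rfl fun k _ => ?_
  rw [Matrix.mul_diagonal, Matrix.star_apply]
  simp only [Function.comp_apply, RCLike.ofReal_real_eq_id, id, star_trivial]
  ring

/-- Eigenvalue upper bound for the quadratic assignment cost (upper half of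
Burkard's Theorem 5): for symmetric `A`, `B`, `Σ_{i,j} A[i,j]·B[σ(i),σ(j)]` is
at most the maximum scalar product of the eigenvalue sequences, for every
permutation `σ`. -/
theorem qap_cost_le_max_scalar_product_eigenvalues
    (n : ℕ) (A B : Matrix (Fin n) (Fin n) ℝ)
    (hA : A.IsHermitian) (hB : B.IsHermitian) (σ : Equiv.Perm (Fin n)) :
    ∑ i, ∑ j, A i j * B (σ i) (σ j)
      ≤ Finset.univ.sup' Finset.univ_nonempty
          (fun π : Equiv.Perm (Fin n) =>
            ∑ i, hA.eigenvalues i * hB.eigenvalues (π i)) := by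
  let U : Matrix (Fin n) (Fin n) ℝ := hA.eigenvectorUnitary.1
  let V : Matrix (Fin n) (Fin n) ℝ := hB.eigenvectorUnitary.1
  have hVσ : V.submatrix σ id ∈ Matrix.orthogonalGroup (Fin n) ℝ := by
    have h : V * star V = 1 := Unitary.coe_mul_star_self hB.eigenvectorUnitary
    rw [Matrix.mem_orthogonalGroup_iff]
    calc V.submatrix σ id * star (V.submatrix σ id) = (V * star V).submatrix σ σ := rfl
      _ = 1 := by rw [h, Matrix.submatrix_one_equiv]
  have hW : star U * V.submatrix σ id ∈ Matrix.orthogonalGroup (Fin n) ℝ :=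
    mul_mem (Unitary.star_mem hA.eigenvectorUnitary.2) hVσ
  refine le_of_eq_of_le ?_ (sum_mul_doublyStochastic_le_sup'
    (Matrix.of_sq_mem_doublyStochastic hW) hA.eigenvalues hB.eigenvalues)
  have hWkl (k l : Fin n) : (star U * V.submatrix σ id) k l = ∑ i, U i k * V (σ i) l := by
    simp [Matrix.mul_apply, Matrix.star_apply]
  calc ∑ i, ∑ j, A i j * B (σ i) (σ j)
      = ∑ i, ∑ j, ∑ k, ∑ l, (U i k * V (σ i) l) * (U j k * V (σ j) l) *
          (hA.eigenvalues k * hB.eigenvalues l) := by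
        refine Finset.sum_congr rfl fun i _ => Finset.sum_congr rfl fun j _ => ?_
        rw [hA.apply_eq_sum_eigenvalues, hB.apply_eq_sum_eigenvalues, Finset.sum_mul_sum]
        refine Finset.sum_congr rfl fun k _ => Finset.sum_congr rfl fun l _ => ?_
        ring
    _ = ∑ k, ∑ l, ∑ i, ∑ j, (U i k * V (σ i) l) * (U j k * V (σ j) l) *
          (hA.eigenvalues k * hB.eigenvalues l) := by
        rw [Finset.sum_comm_cycle]
        exact Finset.sum_congr rfl fun k _ => Finset.sum_comm_cycle
    _ = _ := by
        refine Finset.sum_congr rfl fun k _ => Finset.sum_congr rfl fun l _ => ?_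
        rw [Matrix.of_apply, hWkl, sq, Finset.sum_mul_sum]
        simp only [Finset.sum_mul]
end

section
/- (Tractable upper bound for the maximization form, used for positive similarity measures) Let S be a real n×n matrix, S_A and S_B real symmetric n×n matrices, and σ_gt a permutation of {1,…,n}. Define the max-form structured quadratic assignment loss L_QAP^max = (max over permutations σ of [Σ_i S[i, σ(i)] + Σ_{i,j} S_A[i,j]·S_B[σ(i), σ(j)]]) − Σ_i S[i, σ_gt(i)]. Then L_QAP^max ≤ ⟨λ_A, λ_B⟩₊ + (max over permutations σ of Σ_i S[i, σ(i)]) − Σ_i S[i, σ_gt(i)], where ⟨λ_A, λ_B⟩₊ = max over permutations π of Σ_i λ_A(i)·λ_B(π(i)) is the maximum scalar product of the eigenvalue sequences of S_A and S_B. -/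
open Matrix in
theorem sq_entries_mem_doublyStochastic {ι : Type*} [Fintype ι] [DecidableEq ι]
    {W : Matrix ι ι ℝ} (hW : W ∈ orthogonalGroup ι ℝ) :
    (Matrix.of fun i j => W i j ^ 2) ∈ doublyStochastic ℝ ι := by
  refine mem_doublyStochastic_iff_sum.2 ⟨fun i j => sq_nonneg _, fun i => ?_, fun j => ?_⟩
  · have h := congrFun₂ ((mem_orthogonalGroup_iff ι ℝ).1 hW) i i
    simpa [mul_apply, sq] using h
  · have h := congrFun₂ ((mem_orthogonalGroup_iff' ι ℝ).1 hW) j j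
    simpa [mul_apply, sq] using h

/-- A bilinear form weighted by a doubly stochastic matrix is at most its largest value over
permutation matrices. -/
theorem exists_perm_sum_ge_of_mem_doublyStochastic {ι : Type*} [Fintype ι] [DecidableEq ι]
    {M : Matrix ι ι ℝ} (hM : M ∈ doublyStochastic ℝ ι) (a b : ι → ℝ) :
    ∃ π : Equiv.Perm ι, ∑ i, ∑ j, a i * b j * M i j ≤ ∑ i, a i * b (π i) := by
  let f : Matrix ι ι ℝ →ₗ[ℝ] ℝ :=
    { toFun := fun N => ∑ i, ∑ j, a i * b j * N i j
      map_add' := fun N P => by simp [mul_add, Finset.sum_add_distrib]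
      map_smul' := fun c N => by simp [Finset.mul_sum, mul_left_comm] }
  have hM' : M ∈ (doublyStochastic ℝ ι : Set (Matrix ι ι ℝ)) := hM
  rw [doublyStochastic_eq_convexHull_permMatrix] at hM'
  obtain ⟨_, ⟨π, rfl⟩, hπ⟩ :=
    (f.convexOn convex_univ).exists_ge_of_mem_convexHull (Set.subset_univ _) hM'
  refine ⟨π, hπ.trans_eq ?_⟩
  simp [f, Equiv.Perm.permMatrix, PEquiv.toMatrix_apply]

open Matrix in
/-- The trace inner product of two real symmetric matrices is at most the maximal scalar product
of their eigenvalues. -/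
theorem exists_perm_sum_mul_le_sum_eigenvalues {ι : Type*} [Fintype ι] [DecidableEq ι]
    {A B : Matrix ι ι ℝ} (hA : A.IsHermitian) (hB : B.IsHermitian) :
    ∃ π : Equiv.Perm ι,
      ∑ i, ∑ j, A i j * B i j ≤ ∑ i, hA.eigenvalues i * hB.eigenvalues (π i) := by
  set U : Matrix ι ι ℝ := (hA.eigenvectorUnitary).1
  set V : Matrix ι ι ℝ := (hB.eigenvectorUnitary).1
  set D : Matrix ι ι ℝ := diagonal hA.eigenvalues with hD
  set E : Matrix ι ι ℝ := diagonal hB.eigenvalues with hE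
  have hAU : A = U * D * Uᵀ := by
    have h := hA.spectral_theorem
    rwa [Unitary.conjStarAlgAut_apply] at h
  have hBV : B = V * E * Vᵀ := by
    have h := hB.spectral_theorem
    rwa [Unitary.conjStarAlgAut_apply] at h
  obtain ⟨π, hπ⟩ := exists_perm_sum_ge_of_mem_doublyStochastic
    (sq_entries_mem_doublyStochastic (star hA.eigenvectorUnitary * hB.eigenvectorUnitary).2)
    hA.eigenvalues hB.eigenvalues
  refine ⟨π, le_of_eq_of_le ?_ hπ⟩
  calc ∑ i, ∑ j, A i j * B i j = trace (A * Bᵀ) := by simp [trace, mul_apply]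
    _ = trace (D * (Uᵀ * V) * E * (Uᵀ * V)ᵀ) := by
      rw [show Bᵀ = V * E * Vᵀ by rw [← hBV]; exact hB]
      rw [hAU, transpose_mul, transpose_transpose]
      rw [show U * D * Uᵀ * (V * E * Vᵀ) = U * (D * (Uᵀ * V) * E * Vᵀ) by noncomm_ring,
        trace_mul_comm]
      simp only [Matrix.mul_assoc]
    _ = _ := by
      simp only [hD, hE, trace, diag, mul_apply (N := (Uᵀ * V)ᵀ), mul_diagonal, diagonal_mul,
        transpose_apply]
      refine Finset.sum_congr rfl fun i _ => Finset.sum_congr rfl fun j _ => ?_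
      change _ = _ * _ * (Uᵀ * V) i j ^ 2
      ring

open Matrix in
/-- A quadratic assignment cost is at most the maximal scalar product of the eigenvalues. -/
theorem exists_perm_quadratic_cost_le_sum_eigenvalues {ι : Type*} [Fintype ι] [DecidableEq ι]
    {A B : Matrix ι ι ℝ} (hA : A.IsHermitian) (hB : B.IsHermitian) (σ : Equiv.Perm ι) :
    ∃ π : Equiv.Perm ι,
      ∑ i, ∑ j, A i j * B (σ i) (σ j) ≤ ∑ i, hA.eigenvalues i * hB.eigenvalues (π i) := by
  have hB' : (B.submatrix σ σ).IsHermitian := hB.submatrix σ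
  have h : hB'.eigenvalues = hB.eigenvalues :=
    (IsHermitian.eigenvalues_eq_eigenvalues_iff hB' hB).2 (charpoly_reindex σ.symm B)
  simpa [h] using exists_perm_sum_mul_le_sum_eigenvalues hA hB'

/-- Tractable upper bound for the maximization form of the structured quadratic
assignment loss (positive similarity measures):
`L_QAP^max ≤ ⟨λ_A, λ_B⟩₊ + max_σ c_S(σ) − c_S(σ_gt)`. -/
theorem structured_qap_max_loss_upper_bound
    (n : ℕ) (S SA SB : Matrix (Fin n) (Fin n) ℝ)
    (hA : SA.IsHermitian) (hB : SB.IsHermitian) (σgt : Equiv.Perm (Fin n)) :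
    (Finset.univ.sup' Finset.univ_nonempty
        (fun σ : Equiv.Perm (Fin n) =>
          (∑ i, S i (σ i)) + ∑ i, ∑ j, SA i j * SB (σ i) (σ j)))
      - (∑ i, S i (σgt i))
    ≤ Finset.univ.sup' Finset.univ_nonempty
        (fun π : Equiv.Perm (Fin n) =>
          ∑ i, hA.eigenvalues i * hB.eigenvalues (π i))
      + (Finset.univ.sup' Finset.univ_nonempty
          (fun σ : Equiv.Perm (Fin n) => ∑ i, S i (σ i)))
      - (∑ i, S i (σgt i)) := by
  gcongr
  refine Finset.sup'_le _ _ fun σ _ => ?_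
  obtain ⟨π, hπ⟩ := exists_perm_quadratic_cost_le_sum_eigenvalues hA hB σ
  rw [add_comm]
  exact add_le_add
    (hπ.trans (Finset.le_sup' (fun π : Equiv.Perm (Fin n) =>
      ∑ i, hA.eigenvalues i * hB.eigenvalues (π i)) (Finset.mem_univ π)))
    (Finset.le_sup' (fun σ : Equiv.Perm (Fin n) => ∑ i, S i (σ i)) (Finset.mem_univ σ))
end

section
/- (Closed form of the sparsemax projection onto the simplex) Let z ∈ ℝⁿ (n ≥ 1) and let t ∈ ℝ satisfy Σ_j max(z_j − t, 0) = 1. Define p ∈ ℝⁿ by p_j = max(z_j − t, 0). Then p lies in the probability simplex and for every q in the probability simplex, Σ_j (p_j − z_j)² ≤ Σ_j (q_j − z_j)², with equality only if q = p; that is, p is the unique Euclidean projection of z onto the simplex (p = sparsemax(z)). -/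
/-- Strong convexity of `x ↦ (x - z) ^ 2 - 2 * t * x` at its minimizer `max (z - t) 0` over the
nonnegative reals. -/
theorem sq_max_sub_add_sq_sub_le {q : ℝ} (z t : ℝ) (hq : 0 ≤ q) :
    (max (z - t) 0 - z) ^ 2 + (q - max (z - t) 0) ^ 2
      ≤ (q - z) ^ 2 + 2 * t * (q - max (z - t) 0) := by
  rcases le_total (z - t) 0 with h | h
  · rw [max_eq_right h]
    nlinarith [mul_nonneg hq (sub_nonneg.2 h)]
  · rw [max_eq_left h]
    nlinarith

/-- The Pythagorean inequality for the projection `j ↦ max (z j - t) 0` onto the simplex. -/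
theorem sum_sq_max_sub_add_sum_sq_sub_le {ι : Type*} [Fintype ι] (z q : ι → ℝ) (t : ℝ)
    (hq : ∀ j, 0 ≤ q j) (hsum : ∑ j, q j = ∑ j, max (z j - t) 0) :
    ∑ j, (max (z j - t) 0 - z j) ^ 2 + ∑ j, (q j - max (z j - t) 0) ^ 2
      ≤ ∑ j, (q j - z j) ^ 2 := by
  have h := Finset.sum_le_sum fun j (_ : j ∈ Finset.univ) =>
    sq_max_sub_add_sq_sub_le (z j) t (hq j)
  rw [Finset.sum_add_distrib, Finset.sum_add_distrib, ← Finset.mul_sum,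
    Finset.sum_sub_distrib, hsum, sub_self, mul_zero, add_zero] at h
  exact h


/-- Closed form of the sparsemax projection onto the simplex: if
`Σ_j max(z_j − t, 0) = 1` then `p_j = max(z_j − t, 0)` lies in the probability
simplex and is the unique Euclidean projection of `z` onto it. -/
theorem sparsemax_closed_form
    (n : ℕ) (hn : 1 ≤ n) (z : Fin n → ℝ) (t : ℝ)
    (ht : ∑ j, max (z j - t) 0 = 1) :
    (∀ j, 0 ≤ max (z j - t) 0)
    ∧ (∑ j, max (z j - t) 0) = 1
    ∧ ∀ q : Fin n → ℝ, (∀ j, 0 ≤ q j) → (∑ j, q j) = 1 →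
        (∑ j, (max (z j - t) 0 - z j) ^ 2 ≤ ∑ j, (q j - z j) ^ 2)
        ∧ ((∑ j, (max (z j - t) 0 - z j) ^ 2 = ∑ j, (q j - z j) ^ 2)
            → q = fun j => max (z j - t) 0) := by
  refine ⟨fun j => le_max_right _ _, ht, fun q hq hq1 => ?_⟩
  have h := sum_sq_max_sub_add_sum_sq_sub_le z q t hq (hq1.trans ht.symm)
  have h0 : 0 ≤ ∑ j, (q j - max (z j - t) 0) ^ 2 := Finset.sum_nonneg fun j _ => sq_nonneg _
  refine ⟨by linarith, fun heq => funext fun j => ?_⟩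
  have hz : ∑ j, (q j - max (z j - t) 0) ^ 2 = 0 := by linarith
  have hj := (Finset.sum_eq_zero_iff_of_nonneg fun j _ => sq_nonneg _).1 hz j (Finset.mem_univ j)
  exact sub_eq_zero.1 (pow_eq_zero_iff two_ne_zero |>.1 hj)
end

section
/- (Existence and uniqueness of the sparsemax threshold) For every z ∈ ℝⁿ with n ≥ 1, there exists a unique t ∈ ℝ such that Σ_j max(z_j − t, 0) = 1. -/
/-- If the total excess of `z` over the level `t` is positive, then lowering the level strictly
increases it. -/
theorem sum_max_sub_lt_of_lt {ι : Type*} [Fintype ι] {z : ι → ℝ} {s t : ℝ} (hst : s < t)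
    (ht : 0 < ∑ j, max (z j - t) 0) : ∑ j, max (z j - t) 0 < ∑ j, max (z j - s) 0 := by
  obtain ⟨j, hj, hpos⟩ := Finset.exists_lt_of_sum_lt (f := fun _ => (0 : ℝ)) (by simpa using ht)
  refine Finset.sum_lt_sum (fun i _ => by gcongr) ⟨j, hj, ?_⟩
  have hzt : 0 < z j - t := by simpa using hpos
  rw [max_eq_left hzt.le]
  exact lt_max_of_lt_left (by linarith)

/-- Existence and uniqueness of the sparsemax threshold: for every `z ∈ ℝⁿ`
with `n ≥ 1` there is a unique `t` with `Σ_j max(z_j − t, 0) = 1`. -/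
theorem sparsemax_threshold_existsUnique
    (n : ℕ) (hn : 1 ≤ n) (z : Fin n → ℝ) :
    ∃! t : ℝ, ∑ j, max (z j - t) 0 = 1 := by
  have hcont : Continuous fun t : ℝ => ∑ j, max (z j - t) 0 := by fun_prop
  refine existsUnique_of_exists_of_unique ?_ fun s t hs ht => ?_
  · refine mem_range_of_exists_le_of_exists_ge hcont ?_ ?_
    · obtain ⟨M, hM⟩ := (Set.finite_range z).bddAbove
      refine ⟨M, (Finset.sum_eq_zero fun j _ => ?_).trans_le zero_le_one⟩
      exact max_eq_right (sub_nonpos.2 (hM ⟨j, rfl⟩))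
    · let i : Fin n := ⟨0, hn⟩
      refine ⟨z i - 1, ?_⟩
      calc (1 : ℝ) ≤ max (z i - (z i - 1)) 0 := by simp
        _ ≤ ∑ j, max (z j - (z i - 1)) 0 :=
          Finset.single_le_sum (f := fun j => max (z j - (z i - 1)) 0)
            (fun j _ => le_max_right _ _) (Finset.mem_univ i)
  · rcases lt_trichotomy s t with h | h | h
    · linarith [sum_max_sub_lt_of_lt (z := z) h (by linarith)]
    · exact h
    · linarith [sum_max_sub_lt_of_lt (z := z) h (by linarith)]
end
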